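/- Let G be a connected undirected graph and let X_1,…,X_k be pairwise disjoint subsets of its vertex set such that G \ X_i is connected for every i ∈ {1,…,k}. Let u and v be two vertices of G not belonging to any of X_1,…,X_k, and suppose there is a j ∈ {1,…,k} such that u and v belong to different 2-edge-connected components of G \ X_j. Let T be the tree of the 2-edge-connected components of G \ X_j, and suppose that for every i ∈ {1,…,k} with i ≠ j, either X_i is contained in a single node of T, or there is a leaf node L of T with L ⊆ X_i such that X_i \ L is contained in the node of T adjacent to L. Let G' be the graph obtained from G by contracting each X_i into a single marked vertex (keeping all edges, possibly parallel, between the resulting vertices and discarding loops). Then u and v belong to different marked vertex-edge blocks of G'. -/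

import Mathlib

/-- An undirected multigraph: a type `E` of potential edges, each with two
endpoints, together with the set of edges actually present. -/
structure MultiGraph (V E : Type) where
  edges : Set E
  fst : E → V
  snd : E → V

namespace MultiGraph

variable {V E : Type}

/-- Adjacency in the multigraph. -/
def Adj (G : MultiGraph V E) (a b : V) : Prop :=
  ∃ e ∈ G.edges, (G.fst e = a ∧ G.snd e = b) ∨ (G.fst e = b ∧ G.snd e = a)

/-- `a` and `b` are connected in `G`. -/
def Reach (G : MultiGraph V E) : V → V → Prop :=
  Relation.ReflTransGen G.Adj

/-- Delete a set of vertices (and all incident edges). -/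
def deleteVerts (G : MultiGraph V E) (X : Set V) : MultiGraph V E :=
  { G with edges := {e | e ∈ G.edges ∧ G.fst e ∉ X ∧ G.snd e ∉ X} }

/-- Delete a single edge. -/
def deleteEdge (G : MultiGraph V E) (e : E) : MultiGraph V E :=
  { G with edges := G.edges \ {e} }

/-- `a` and `b` belong to the same 2-edge-connected component of `G` :
they remain connected after the deletion of any single edge. -/
def Same2ECC (G : MultiGraph V E) (a b : V) : Prop :=
  ∀ e ∈ G.edges, (G.deleteEdge e).Reach a b

/-- The 2-edge-connected component of `G` containing `c`
(a node of the tree of 2-edge-connected components). -/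
def eccOf (G : MultiGraph V E) (c : V) : Set V := {w | G.Same2ECC c w}

/-- A bridge of the undirected multigraph `G`. -/
def IsBridge (G : MultiGraph V E) (e : E) : Prop :=
  e ∈ G.edges ∧ ¬ (G.deleteEdge e).Reach (G.fst e) (G.snd e)

/-- The image of a vertex under the contraction of each set `X i` to the new
(marked) vertex `Sum.inr i`. -/
noncomputable def contractMap (k : ℕ) (X : Fin k → Set V) (w : V) :
    V ⊕ Fin k := by
  classical
  exact if h : ∃ i, w ∈ X i then Sum.inr h.choose else Sum.inl w

/-- The graph obtained from `G` by contracting each set `X i` into the single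
(marked) vertex `Sum.inr i`, keeping all (possibly parallel) edges between the
resulting vertices and discarding loops. -/
noncomputable def contract (G : MultiGraph V E) (k : ℕ) (X : Fin k → Set V) :
    MultiGraph (V ⊕ Fin k) E where
  edges := {e | e ∈ G.edges ∧
    contractMap k X (G.fst e) ≠ contractMap k X (G.snd e)}
  fst := fun e => contractMap k X (G.fst e)
  snd := fun e => contractMap k X (G.snd e)

/-- `a` and `b` belong to the same marked vertex-edge block of `G` (with
marked vertex set `M`): for every marked vertex `z` and every edge `e`, they
remain connected after deleting both `z` and `e`. -/
def SameMVEB (G : MultiGraph V E) (M : Set V) (a b : V) : Prop :=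
  ∀ z ∈ M, ∀ e ∈ G.edges, ((G.deleteVerts {z}).deleteEdge e).Reach a b

end MultiGraph

namespace MultiGraph

variable {V E : Type}

theorem Reach.symm {G : MultiGraph V E} {a b : V} (h : G.Reach a b) : G.Reach b a := by
  induction h with
  | refl => exact Relation.ReflTransGen.refl
  | tail _ hadj ih =>
    obtain ⟨e, he, hends⟩ := hadj
    exact Relation.ReflTransGen.head ⟨e, he, hends.symm⟩ ih

theorem Reach.trans {G : MultiGraph V E} {a b c : V} (h : G.Reach a b) (hbc : G.Reach b c) :
    G.Reach a c :=
  Relation.ReflTransGen.trans h hbc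

theorem reach_of_mem_edges {G : MultiGraph V E} {e : E} (he : e ∈ G.edges) :
    G.Reach (G.fst e) (G.snd e) :=
  Relation.ReflTransGen.single ⟨e, he, Or.inl ⟨rfl, rfl⟩⟩

theorem deleteEdge_reach_of_ne {G : MultiGraph V E} {e g : E} (hg : g ∈ G.edges) (hne : g ≠ e) :
    (G.deleteEdge e).Reach (G.fst g) (G.snd g) :=
  reach_of_mem_edges (G := G.deleteEdge e) ⟨hg, hne⟩

theorem Same2ECC.symm {G : MultiGraph V E} {a b : V} (h : G.Same2ECC a b) : G.Same2ECC b a :=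
  fun e he => (h e he).symm

theorem Same2ECC.trans {G : MultiGraph V E} {a b c : V} (h : G.Same2ECC a b)
    (hbc : G.Same2ECC b c) : G.Same2ECC a c :=
  fun e he => (h e he).trans (hbc e he)

/-- An edge that is not a bridge joins vertices of the same 2-edge-connected component. -/
theorem same2ECC_of_not_isBridge {G : MultiGraph V E} {g : E} (hg : g ∈ G.edges)
    (hb : ¬ G.IsBridge g) : G.Same2ECC (G.fst g) (G.snd g) := by
  intro e he
  by_cases hge : g = e
  · subst hge
    by_contra h
    exact hb ⟨hg, h⟩
  · exact deleteEdge_reach_of_ne hg hge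

/-- Membership in a set `L` is preserved by all walks that use only edges respecting `L`. -/
theorem Reach.mem_of_closed {G : MultiGraph V E} {L : Set V}
    (hL : ∀ g ∈ G.edges, (G.fst g ∈ L ↔ G.snd g ∈ L)) {a b : V} (h : G.Reach a b)
    (ha : a ∈ L) : b ∈ L := by
  induction h with
  | refl => exact ha
  | tail _ hadj ih =>
    obtain ⟨g, hg, ⟨rfl, rfl⟩ | ⟨rfl, rfl⟩⟩ := hadj
    · exact (hL g hg).1 ih
    · exact (hL g hg).2 ih

/-- If `L` is a union of components of `G - e` containing an end of `e`, then two connected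
vertices outside `L` remain connected after the deletion of `e`. -/
theorem Reach.deleteEdge_of_notMem {G : MultiGraph V E} {L : Set V} {e : E}
    (hL : ∀ g ∈ (G.deleteEdge e).edges, (G.fst g ∈ L ↔ G.snd g ∈ L))
    (he : G.fst e ∈ L ∨ G.snd e ∈ L) {a b : V} (h : G.Reach a b) (ha : a ∉ L) (hb : b ∉ L) :
    (G.deleteEdge e).Reach a b := by
  have key : (G.deleteEdge e).Reach a b ∨ (b ∈ L ∧
      ∃ n, (n = G.fst e ∨ n = G.snd e) ∧ n ∉ L ∧ (G.deleteEdge e).Reach a n) := by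
    clear hb
    have hout : ∀ x, (G.deleteEdge e).Reach a x → x ∉ L := fun x hx hxL =>
      ha (Reach.mem_of_closed (G := G.deleteEdge e) hL hx.symm hxL)
    induction h with
    | refl => exact Or.inl Relation.ReflTransGen.refl
    | tail _ hadj ih =>
      obtain ⟨g, hg, hends⟩ := hadj
      by_cases hge : g = e
      · subst hge
        grind
      · have hr := deleteEdge_reach_of_ne hg hge
        have hl := hL g ⟨hg, hge⟩
        obtain ⟨rfl, rfl⟩ | ⟨rfl, rfl⟩ := hends
        · exact ih.imp (fun h => h.trans hr) (fun h => ⟨hl.1 h.1, h.2⟩)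
        · exact ih.imp (fun h => h.trans hr.symm) (fun h => ⟨hl.2 h.1, h.2⟩)
  exact key.resolve_right fun h => hb h.1

/-- Two connected vertices outside a leaf of the bridge tree are not separated by the bridge
incident to that leaf. -/
theorem Reach.deleteEdge_of_leaf {G : MultiGraph V E} {c : V} {e : E}
    (he : G.fst e ∈ G.eccOf c ∨ G.snd e ∈ G.eccOf c)
    (hleaf : ∀ g, G.IsBridge g → (G.fst g ∈ G.eccOf c ∨ G.snd g ∈ G.eccOf c) → g = e)
    {a b : V} (h : G.Reach a b) (ha : a ∉ G.eccOf c) (hb : b ∉ G.eccOf c) :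
    (G.deleteEdge e).Reach a b := by
  refine h.deleteEdge_of_notMem ?_ he ha hb
  rintro g ⟨hg, hge⟩
  by_cases hbr : G.IsBridge g
  · have : ¬ (G.fst g ∈ G.eccOf c ∨ G.snd g ∈ G.eccOf c) := fun h => hge (hleaf g hbr h)
    tauto
  · have hs := same2ECC_of_not_isBridge hg hbr
    exact ⟨fun h => Same2ECC.trans h hs, fun h => Same2ECC.trans h hs.symm⟩

theorem contractMap_of_mem {k : ℕ} {X : Fin k → Set V}
    (hdisj : ∀ i j : Fin k, i ≠ j → Disjoint (X i) (X j)) {w : V} {i : Fin k} (hw : w ∈ X i) :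
    contractMap k X w = Sum.inr i := by
  have h : ∃ i, w ∈ X i := ⟨i, hw⟩
  rw [contractMap, dif_pos h]
  by_contra hne
  exact Set.disjoint_left.1 (hdisj _ _ fun heq => hne (congrArg Sum.inr heq)) h.choose_spec hw

theorem contractMap_of_notMem {k : ℕ} {X : Fin k → Set V} {w : V} (hw : ∀ i, w ∉ X i) :
    contractMap k X w = Sum.inl w := by
  rw [contractMap, dif_neg (not_exists.2 hw)]

/-- If every `X i` with `i ≠ j` lies in one component of `(G \ X j) - e` and the edge `e`
separates `u` from `v` in the connected graph `G \ X j`, then the contracted graph has `u` and `v`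
in different marked vertex-edge blocks. -/
theorem not_sameMVEB_contract {G : MultiGraph V E} {k : ℕ} {X : Fin k → Set V}
    (hdisj : ∀ i j : Fin k, i ≠ j → Disjoint (X i) (X j)) {u v : V} (hu : ∀ i, u ∉ X i)
    (hv : ∀ i, v ∉ X i) {j : Fin k} {e : E} (he : e ∈ (G.deleteVerts (X j)).edges)
    (huv : (G.deleteVerts (X j)).Reach u v)
    (hsep : ¬ ((G.deleteVerts (X j)).deleteEdge e).Reach u v)
    (hside : ∀ i, i ≠ j → ∀ a ∈ X i, ∀ b ∈ X i,
      ((G.deleteVerts (X j)).deleteEdge e).Reach a b) :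
    ¬ (G.contract k X).SameMVEB (Set.range Sum.inr) (Sum.inl u) (Sum.inl v) := by
  set H := G.deleteVerts (X j) with hH
  have hbridge : ¬ (H.deleteEdge e).Reach (H.fst e) (H.snd e) := by
    intro hr
    refine hsep (Reach.mem_of_closed (L := {w | (H.deleteEdge e).Reach u w}) ?_ huv
      Relation.ReflTransGen.refl)
    intro g hg
    have hr' : (H.deleteEdge e).Reach (H.fst g) (H.snd g) := by
      by_cases hge : g = e
      · rwa [hge]
      · exact deleteEdge_reach_of_ne hg hge
    exact ⟨fun h => Reach.trans h hr', fun h => Reach.trans h hr'.symm⟩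
  have hmap : ∀ a b, a ∉ X j → contractMap k X a = contractMap k X b →
      (H.deleteEdge e).Reach a b := by
    intro a b haj hab
    by_cases ha : ∃ i, a ∈ X i
    · obtain ⟨i, hi⟩ := ha
      rw [contractMap_of_mem hdisj hi] at hab
      by_cases hb : ∃ i', b ∈ X i'
      · obtain ⟨i', hi'⟩ := hb
        rw [contractMap_of_mem hdisj hi'] at hab
        obtain rfl := Sum.inr.inj hab
        exact hside i (fun h => haj (h ▸ hi)) a hi b hi'
      · rw [contractMap_of_notMem (not_exists.1 hb)] at hab
        cases hab
    · rw [contractMap_of_notMem (not_exists.1 ha)] at hab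
      by_cases hb : ∃ i', b ∈ X i'
      · obtain ⟨i', hi'⟩ := hb
        rw [contractMap_of_mem hdisj hi'] at hab
        cases hab
      · rw [contractMap_of_notMem (not_exists.1 hb)] at hab
        obtain rfl := Sum.inl.inj hab
        exact Relation.ReflTransGen.refl
  intro hsame
  have hreach := hsame (Sum.inr j) ⟨j, rfl⟩ e
    ⟨he.1, fun h => hbridge (hmap _ _ he.2.1 h)⟩
  have hvL : Sum.inl v ∈ {p | ∃ w, w ∉ X j ∧ contractMap k X w = p ∧
      (H.deleteEdge e).Reach u w} := by
    refine Reach.mem_of_closed ?_ hreach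
      ⟨u, hu j, contractMap_of_notMem hu, Relation.ReflTransGen.refl⟩
    rintro g ⟨⟨⟨hgG, -⟩, hg1, hg2⟩, hge⟩
    have h1 : G.fst g ∉ X j := fun h => hg1 (contractMap_of_mem hdisj h)
    have h2 : G.snd g ∉ X j := fun h => hg2 (contractMap_of_mem hdisj h)
    have hr : (H.deleteEdge e).Reach (G.fst g) (G.snd g) :=
      deleteEdge_reach_of_ne (G := H) ⟨hgG, h1, h2⟩ hge
    constructor
    · rintro ⟨w, hw, hwe, hwr⟩
      exact ⟨G.snd g, h2, rfl, (hwr.trans (hmap _ _ hw hwe)).trans hr⟩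
    · rintro ⟨w, hw, hwe, hwr⟩
      exact ⟨G.fst g, h1, rfl, (hwr.trans (hmap _ _ hw hwe)).trans hr.symm⟩
  obtain ⟨w, hw, hwe, hwr⟩ := hvL
  exact hsep (hwr.trans (hmap _ _ hw (hwe.trans (contractMap_of_notMem hv).symm)))

end MultiGraph

/-- Let `G` be connected, `X 0, …, X (k-1)` pairwise disjoint
vertex sets with each `G \ X i` connected, and `u`, `v` vertices outside all
`X i`. Suppose `u` and `v` lie in different 2-edge-connected components of
`H := G \ X j` for some `j`, and that for every `i ≠ j` either `X i` is
contained in a single node of the tree `T` of 2-edge-connected components of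
`H`, or a part of `X i` constitutes a leaf node `L` of `T` (a node incident to
exactly one bridge of `H`) and `X i \ L` is contained in the node of `T`
adjacent to `L`. Then, in the graph `G'` obtained by contracting each `X i` to
a single marked vertex, `u` and `v` belong to different marked vertex-edge
blocks. -/
theorem statement_17 {V E : Type} (G : MultiGraph V E) (k : ℕ)
    (X : Fin k → Set V)
    (hdisj : ∀ i j : Fin k, i ≠ j → Disjoint (X i) (X j))
    (hconn : ∀ a b : V, G.Reach a b)
    (hXconn : ∀ i : Fin k, ∀ a b : V, a ∉ X i → b ∉ X i →
      (G.deleteVerts (X i)).Reach a b)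
    (u v : V) (hu : ∀ i, u ∉ X i) (hv : ∀ i, v ∉ X i)
    (j : Fin k) (hsep : ¬ (G.deleteVerts (X j)).Same2ECC u v)
    (hT : ∀ i : Fin k, i ≠ j →
      (∃ c : V, c ∉ X j ∧ X i ⊆ (G.deleteVerts (X j)).eccOf c) ∨
      (∃ c : V, ∃ e : E, c ∉ X j ∧
        (G.deleteVerts (X j)).eccOf c ⊆ X i ∧
        (G.deleteVerts (X j)).IsBridge e ∧
        ((G.deleteVerts (X j)).fst e ∈ (G.deleteVerts (X j)).eccOf c ∨
          (G.deleteVerts (X j)).snd e ∈ (G.deleteVerts (X j)).eccOf c) ∧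
        (∀ e' : E, (G.deleteVerts (X j)).IsBridge e' →
          ((G.deleteVerts (X j)).fst e' ∈ (G.deleteVerts (X j)).eccOf c ∨
            (G.deleteVerts (X j)).snd e' ∈ (G.deleteVerts (X j)).eccOf c) →
          e' = e) ∧
        (((G.deleteVerts (X j)).fst e ∈ (G.deleteVerts (X j)).eccOf c ∧
            X i \ (G.deleteVerts (X j)).eccOf c ⊆
              (G.deleteVerts (X j)).eccOf ((G.deleteVerts (X j)).snd e)) ∨
          ((G.deleteVerts (X j)).snd e ∈ (G.deleteVerts (X j)).eccOf c ∧
            X i \ (G.deleteVerts (X j)).eccOf c ⊆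
              (G.deleteVerts (X j)).eccOf ((G.deleteVerts (X j)).fst e))))) :
    ¬ (G.contract k X).SameMVEB (Set.range Sum.inr)
        (Sum.inl u) (Sum.inl v) := by
  have huv := hXconn j u v (hu j) (hv j)
  obtain ⟨e, he, hne⟩ :
      ∃ e ∈ (G.deleteVerts (X j)).edges, ¬ ((G.deleteVerts (X j)).deleteEdge e).Reach u v := by
    simpa [MultiGraph.Same2ECC] using hsep
  refine MultiGraph.not_sameMVEB_contract hdisj hu hv he huv hne ?_
  intro i hij a ha b hb
  generalize G.deleteVerts (X j) = H at *
  obtain ⟨c, -, hc⟩ | ⟨c, f, -, hLX, hf, hfL, hleaf, hrest⟩ := hT i hij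
  · exact (hc ha e he).symm.trans (hc hb e he)
  · by_cases hfe : f = e
    · subst hfe
      exact absurd (huv.deleteEdge_of_leaf hfL hleaf (fun h => hu i (hLX h))
        (fun h => hv i (hLX h))) hne
    · have hr := MultiGraph.deleteEdge_reach_of_ne hf.1 hfe
      have hall : ∀ x ∈ X i, (H.deleteEdge e).Reach c x := by
        intro x hx
        by_cases hxL : x ∈ H.eccOf c
        · exact hxL e he
        · obtain ⟨h1, h2⟩ | ⟨h1, h2⟩ := hrest
          · exact ((h1 e he).trans hr).trans (h2 ⟨hx, hxL⟩ e he)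
          · exact ((h1 e he).trans hr.symm).trans (h2 ⟨hx, hxL⟩ e he)
      exact (hall a ha).symm.trans (hall b hb)
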